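/- Let G be a 3-partite graph with vertex partition (V₁,V₂,V₃) in which every edge joins V₁ to V₂ or V₂ to V₃, and let k be a natural number. Let u ∈ V₁ and v ∈ V₃, and let Q(u,v) be the set of vertices w ∈ V₂ whose set of neighbours in G is exactly {u,v}. Suppose |Q(u,v)| > k+1 and let w ∈ Q(u,v). Then G admits a 3-layer drawing respecting (V₁,V₂,V₃) with at most k crossings if and only if G − w admits a 3-layer drawing respecting (V₁, V₂∖{w}, V₃) with at most k crossings. -/

import Mathlib

/-- The number of crossings of a 3-layer drawing `σ` of a 3-partite graph `G` with
parts `P₁, P₂, P₃`: every unordered crossing pair of edges is counted exactly once. -/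
noncomputable def crossNum3 {V : Type*} (G : SimpleGraph V) (P₁ P₂ P₃ : Set V)
    (σ : V → ℝ) : ℕ :=
  Set.ncard {q : V × V × V × V |
    ((q.1 ∈ P₁ ∧ q.2.2.1 ∈ P₁ ∧ q.2.1 ∈ P₂ ∧ q.2.2.2 ∈ P₂) ∨
      (q.1 ∈ P₂ ∧ q.2.2.1 ∈ P₂ ∧ q.2.1 ∈ P₃ ∧ q.2.2.2 ∈ P₃)) ∧
    G.Adj q.1 q.2.1 ∧ G.Adj q.2.2.1 q.2.2.2 ∧
    σ q.1 < σ q.2.2.1 ∧ σ q.2.2.2 < σ q.2.1}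

/-- `G` admits a 3-layer drawing respecting `(P₁, P₂, P₃)` with at most `k` crossings. -/
def AdmitsDrawing {V : Type*} (G : SimpleGraph V) (P₁ P₂ P₃ : Set V) (k : ℕ) : Prop :=
  ∃ σ : V → ℝ, (Set.InjOn σ P₁ ∧ Set.InjOn σ P₂ ∧ Set.InjOn σ P₃) ∧
    crossNum3 G P₁ P₂ P₃ σ ≤ k

/-- The crossings of `σ`, as ordered quadruples. -/
def crossings3 {V : Type*} (G : SimpleGraph V) (P₁ P₂ P₃ : Set V) (σ : V → ℝ) :
    Set (V × V × V × V) :=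
  {q | ((q.1 ∈ P₁ ∧ q.2.2.1 ∈ P₁ ∧ q.2.1 ∈ P₂ ∧ q.2.2.2 ∈ P₂) ∨
      (q.1 ∈ P₂ ∧ q.2.2.1 ∈ P₂ ∧ q.2.1 ∈ P₃ ∧ q.2.2.2 ∈ P₃)) ∧
    G.Adj q.1 q.2.1 ∧ G.Adj q.2.2.1 q.2.2.2 ∧
    σ q.1 < σ q.2.2.1 ∧ σ q.2.2.2 < σ q.2.1}

/-- `w` is an endpoint of one of the two edges in the quadruple `q`. -/
def IsCrossingEnd {V : Type*} (q : V × V × V × V) (w : V) : Prop :=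
  q.1 = w ∨ q.2.1 = w ∨ q.2.2.1 = w ∨ q.2.2.2 = w

theorem AdmitsDrawing.mono {V : Type*} [Finite V] {G : SimpleGraph V} {P₁ P₂ P₂' P₃ : Set V}
    {k : ℕ} (hP : P₂' ⊆ P₂) (h : AdmitsDrawing G P₁ P₂ P₃ k) :
    AdmitsDrawing G P₁ P₂' P₃ k := by
  obtain ⟨σ, ⟨i₁, i₂, i₃⟩, hc⟩ := h
  refine ⟨σ, ⟨i₁, i₂.mono hP, i₃⟩, le_trans (Set.ncard_le_ncard ?_ (Set.toFinite _)) hc⟩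
  rintro ⟨a, b, c, d⟩ ⟨h, h'⟩
  exact ⟨h.imp (fun h => ⟨h.1, h.2.1, hP h.2.2.1, hP h.2.2.2⟩)
    (fun h => ⟨hP h.1, hP h.2.1, h.2.2⟩), h'⟩

/-- A crossing involves at most one middle vertex with neighbourhood `{u, v}`. -/
theorem eq_of_isCrossingEnd {V : Type*} {G : SimpleGraph V} {P₁ P₂ P₃ : Set V} {σ : V → ℝ}
    (h12 : Disjoint P₁ P₂) (h13 : Disjoint P₁ P₃) (h23 : Disjoint P₂ P₃)
    {u v : V} (hu : u ∈ P₁) (hv : v ∈ P₃) {q : V × V × V × V}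
    (hq : q ∈ crossings3 G P₁ P₂ P₃ σ) {w w' : V} (hw : w ∈ P₂) (hw' : w' ∈ P₂)
    (hn : ∀ y, G.Adj w y ↔ y = u ∨ y = v) (hn' : ∀ y, G.Adj w' y ↔ y = u ∨ y = v)
    (hqw : IsCrossingEnd q w) (hqw' : IsCrossingEnd q w') : w = w' := by
  obtain ⟨a, b, c, d⟩ := q
  obtain ⟨hP, hab, hcd, hac, hdb⟩ := hq
  simp only [IsCrossingEnd] at *
  rw [Set.disjoint_left] at h12 h13 h23
  have hab' := hab.symm
  have hcd' := hcd.symm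
  rcases hP with ⟨ha, hc, hb, hd⟩ | ⟨ha, hc, hb, hd⟩ <;> grind

/-- Given more than `k` middle vertices with neighbourhood `{u, v}` and at most `k` crossings,
some such vertex is involved in no crossing. -/
theorem exists_not_isCrossingEnd {V : Type*} [Finite V] {G : SimpleGraph V} {P₁ P₂ P₃ : Set V}
    {σ : V → ℝ} (h12 : Disjoint P₁ P₂) (h13 : Disjoint P₁ P₃) (h23 : Disjoint P₂ P₃)
    {u v : V} (hu : u ∈ P₁) (hv : v ∈ P₃) {S : Set V}
    (hS : ∀ w ∈ S, w ∈ P₂ ∧ ∀ y, G.Adj w y ↔ y = u ∨ y = v)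
    (hcard : (crossings3 G P₁ P₂ P₃ σ).ncard < S.ncard) :
    ∃ w ∈ S, ∀ q ∈ crossings3 G P₁ P₂ P₃ σ, ¬ IsCrossingEnd q w := by
  by_contra! h
  choose! f hf hfw using h
  refine hcard.not_ge (Set.ncard_le_ncard_of_injOn f hf ?_ (Set.toFinite _))
  intro w hw w' hw' e
  exact eq_of_isCrossingEnd h12 h13 h23 hu hv (hf w hw) (hS w hw).1 (hS w' hw').1
    (hS w hw).2 (hS w' hw').2 (hfw w hw) (e ▸ hfw w' hw')

theorem exists_gt_forall_lt_of_finite {V : Type*} [Finite V] (σ : V → ℝ) (s : ℝ) :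
    ∃ t, s < t ∧ ∀ x, s < σ x → t < σ x := by
  have h : ∀ᶠ t in nhdsWithin s (Set.Ioi s), ∀ x, s < σ x → t < σ x := by
    refine Filter.eventually_all.2 fun x => ?_
    by_cases hx : s < σ x
    · filter_upwards [Ioo_mem_nhdsGT hx] with t ht _ using ht.2
    · exact Filter.Eventually.of_forall fun t h => absurd h hx
  obtain ⟨t, ht, hst⟩ := (h.and self_mem_nhdsWithin).exists
  exact ⟨t, hst, ht⟩

/-- Inserting `w₀` directly after an uncrossed vertex `w` with the same neighbourhood `{u, v}`
creates no crossing. -/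
theorem crossings3_update_subset {V : Type*} [DecidableEq V] {G : SimpleGraph V}
    {P₁ P₂ P₃ : Set V} {σ : V → ℝ}
    (h12 : Disjoint P₁ P₂) (h13 : Disjoint P₁ P₃) (h23 : Disjoint P₂ P₃)
    {u v : V} (hu : u ∈ P₁) (hv : v ∈ P₃) {w₀ w : V} (hw₀ : w₀ ∈ P₂) (hw : w ∈ P₂ \ {w₀})
    (hn₀ : ∀ y, G.Adj w₀ y ↔ y = u ∨ y = v) (hn : ∀ y, G.Adj w y ↔ y = u ∨ y = v)
    (hσ : Set.InjOn σ (P₂ \ {w₀}))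
    (hfree : ∀ q ∈ crossings3 G P₁ (P₂ \ {w₀}) P₃ σ, ¬ IsCrossingEnd q w)
    {t : ℝ} (ht : σ w < t) (htσ : ∀ x, σ w < σ x → t < σ x) :
    crossings3 G P₁ P₂ P₃ (Function.update σ w₀ t) ⊆
      crossings3 G P₁ (P₂ \ {w₀}) P₃ σ := by
  rw [Set.disjoint_left] at h12 h13 h23
  have below : ∀ x ∈ P₂, x ≠ w₀ → x ≠ w → σ x < t → σ x < σ w := fun x hx h0 hxw hxt =>
    lt_of_le_of_ne (not_lt.1 fun h => (htσ x h).not_gt hxt) fun e => hxw (hσ ⟨hx, h0⟩ hw e)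
  have hne₁ : ∀ x ∈ P₁, x ≠ w₀ := fun x hx e => h12 hx (e ▸ hw₀)
  have hne₃ : ∀ x ∈ P₃, x ≠ w₀ := fun x hx e => h23 hw₀ (e ▸ hx)
  have hwu := (hn u).2 (Or.inl rfl)
  have hwv := (hn v).2 (Or.inr rfl)
  have eq_u : ∀ x ∈ P₁, G.Adj w₀ x → x = u := fun x hx h =>
    ((hn₀ x).1 h).resolve_right fun e => h13 hx (e ▸ hv)
  have eq_u' : ∀ x ∈ P₁, G.Adj w x → x = u := fun x hx h =>
    ((hn x).1 h).resolve_right fun e => h13 hx (e ▸ hv)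
  have eq_v : ∀ x ∈ P₃, G.Adj w₀ x → x = v := fun x hx h =>
    ((hn₀ x).1 h).resolve_left fun e => h13 hu (e ▸ hx)
  have eq_v' : ∀ x ∈ P₃, G.Adj w x → x = v := fun x hx h =>
    ((hn x).1 h).resolve_left fun e => h13 hu (e ▸ hx)
  rintro ⟨a, b, c, d⟩ ⟨hP, hab, hcd, hac, hdb⟩
  simp only at hP hab hcd hac hdb
  rcases hP with ⟨ha, hc, hb, hd⟩ | ⟨ha, hc, hb, hd⟩
  · rw [Function.update_of_ne (hne₁ a ha), Function.update_of_ne (hne₁ c hc)] at hac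
    have hbw : b ≠ w₀ := by
      rintro rfl
      obtain rfl := eq_u a ha hab.symm
      have hdw : d ≠ b := by rintro rfl; exact hdb.false
      rw [Function.update_self, Function.update_of_ne hdw] at hdb
      have hdw' : d ≠ w := by
        rintro rfl
        exact hac.ne' (congrArg σ (eq_u' c hc hcd.symm))
      exact hfree (a, w, c, d) ⟨Or.inl ⟨ha, hc, hw, hd, hdw⟩, hwu.symm, hcd, hac,
        below d hd hdw hdw' hdb⟩ (Or.inr (Or.inl rfl))
    have hdw : d ≠ w₀ := by
      rintro rfl
      obtain rfl := eq_u c hc hcd.symm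
      rw [Function.update_self, Function.update_of_ne hbw] at hdb
      exact hfree (a, b, c, w) ⟨Or.inl ⟨ha, hc, ⟨hb, hbw⟩, hw⟩, hab, hwu.symm, hac,
        ht.trans hdb⟩ (Or.inr (Or.inr (Or.inr rfl)))
    rw [Function.update_of_ne hbw, Function.update_of_ne hdw] at hdb
    exact ⟨Or.inl ⟨ha, hc, ⟨hb, hbw⟩, ⟨hd, hdw⟩⟩, hab, hcd, hac, hdb⟩
  · rw [Function.update_of_ne (hne₃ b hb), Function.update_of_ne (hne₃ d hd)] at hdb
    have hcw : c ≠ w₀ := by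
      rintro rfl
      obtain rfl := eq_v d hd hcd
      have haw : a ≠ c := by rintro rfl; exact hac.false
      rw [Function.update_self, Function.update_of_ne haw] at hac
      have haw' : a ≠ w := by
        rintro rfl
        exact hdb.ne' (congrArg σ (eq_v' b hb hab))
      exact hfree (a, b, w, d) ⟨Or.inr ⟨⟨ha, haw⟩, hw, hb, hd⟩, hab, hwv,
        below a ha haw haw' hac, hdb⟩ (Or.inr (Or.inr (Or.inl rfl)))
    have haw : a ≠ w₀ := by
      rintro rfl
      obtain rfl := eq_v b hb hab
      rw [Function.update_self, Function.update_of_ne hcw] at hac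
      exact hfree (w, b, c, d) ⟨Or.inr ⟨hw, ⟨hc, hcw⟩, hb, hd⟩, hwv, hcd,
        ht.trans hac, hdb⟩ (Or.inl rfl)
    rw [Function.update_of_ne haw, Function.update_of_ne hcw] at hac
    exact ⟨Or.inr ⟨⟨ha, haw⟩, ⟨hc, hcw⟩, hb, hd⟩, hab, hcd, hac, hdb⟩

/-- Deleting one of more than `k + 1` common degree-two middle-layer neighbours of a pair
`u ∈ V₁`, `v ∈ V₃` preserves `k`-drawability. -/
theorem degree_two_vertex_reduction {V : Type*} [Fintype V] [DecidableEq V]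
    (G : SimpleGraph V) (P₁ P₂ P₃ : Set V)
    (hcov : P₁ ∪ P₂ ∪ P₃ = Set.univ)
    (h12 : Disjoint P₁ P₂) (h13 : Disjoint P₁ P₃) (h23 : Disjoint P₂ P₃)
    (hedge : ∀ a b : V, G.Adj a b →
      (a ∈ P₁ ∧ b ∈ P₂) ∨ (a ∈ P₂ ∧ b ∈ P₁) ∨ (a ∈ P₂ ∧ b ∈ P₃) ∨ (a ∈ P₃ ∧ b ∈ P₂))
    (k : ℕ) (u : V) (hu : u ∈ P₁) (v : V) (hv : v ∈ P₃)
    (hmany : k + 1 < Set.ncard {w : V | w ∈ P₂ ∧ G.neighborSet w = {u, v}})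
    (w₀ : V) (hw₀ : w₀ ∈ P₂) (hw₀n : G.neighborSet w₀ = {u, v}) :
    AdmitsDrawing G P₁ P₂ P₃ k ↔
      AdmitsDrawing G P₁ (P₂ \ {w₀}) P₃ k := by
  refine ⟨AdmitsDrawing.mono Set.sdiff_subset, ?_⟩
  rintro ⟨σ, ⟨i₁, i₂, i₃⟩, hc⟩
  have adj_iff : ∀ {w}, G.neighborSet w = {u, v} → ∀ y, G.Adj w y ↔ y = u ∨ y = v :=
    fun h y => by simpa using Set.ext_iff.1 h y
  have h12' : Disjoint P₁ (P₂ \ {w₀}) := h12.mono_right Set.sdiff_subset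
  have h23' : Disjoint (P₂ \ {w₀}) P₃ := h23.mono_left Set.sdiff_subset
  have hcard : (crossings3 G P₁ (P₂ \ {w₀}) P₃ σ).ncard <
      ({w : V | w ∈ P₂ ∧ G.neighborSet w = {u, v}} \ {w₀}).ncard := by
    rw [Set.ncard_sdiff_singleton_of_mem (Set.mem_ofPred_eq ▸ ⟨hw₀, hw₀n⟩)]
    exact lt_of_le_of_lt hc (by omega)
  obtain ⟨w, ⟨⟨hw, hwn⟩, hww₀⟩, hfree⟩ := exists_not_isCrossingEnd h12' h13 h23' hu hv
    (fun w hw => ⟨⟨hw.1.1, hw.2⟩, adj_iff hw.1.2⟩) hcard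
  obtain ⟨t, ht, htσ⟩ := exists_gt_forall_lt_of_finite σ (σ w)
  have hne : ∀ x, σ x ≠ t := fun x e => (htσ x (e ▸ ht)).ne' e
  refine ⟨Function.update σ w₀ t, ⟨?_, ?_, ?_⟩, ?_⟩
  · refine i₁.congr fun x hx => (Function.update_of_ne ?_ _ _).symm
    rintro rfl
    exact Set.disjoint_left.1 h12 hx hw₀
  · intro x hx y hy e
    by_cases hx₀ : x = w₀ <;> by_cases hy₀ : y = w₀
    · exact hx₀.trans hy₀.symm
    · simp only [hx₀, Function.update_self, Function.update_of_ne hy₀] at e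
      exact absurd e.symm (hne y)
    · simp only [hy₀, Function.update_self, Function.update_of_ne hx₀] at e
      exact absurd e (hne x)
    · rw [Function.update_of_ne hx₀, Function.update_of_ne hy₀] at e
      exact i₂ ⟨hx, hx₀⟩ ⟨hy, hy₀⟩ e
  · refine i₃.congr fun x hx => (Function.update_of_ne ?_ _ _).symm
    rintro rfl
    exact Set.disjoint_left.1 h23 hw₀ hx
  · exact (Set.ncard_le_ncard (crossings3_update_subset h12 h13 h23 hu hv hw₀ ⟨hw, hww₀⟩
      (adj_iff hw₀n) (adj_iff hwn) i₂ hfree ht htσ) (Set.toFinite _)).trans hc
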